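/- arXiv:1210.0092 — 8 statements merged into one kernel-verified Lean document; each statement's English description precedes it below -/
import Mathlib

section
/- Let q : ℕ → ℝ be the sequence defined by q(1) = 4 and q(t) = 4 − 2/q(t−1) for all t ≥ 2. Then for every t ≥ 1, q(t) = 2 − √2 + 2√2/(1 − (3 − 2√2)^t). -/
/-- The Möbius map `y ↦ 4 - 2 / y`, in the coordinate `x` with `y = 2 - r + 2 * r / (1 - x)`, is
multiplication by `3 - 2 * r`, where `r ^ 2 = 2`. -/
theorem four_sub_two_div_eq {r x : ℝ} (hr : r ^ 2 = 2) (hx : 1 - x ≠ 0)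
    (hN : 2 + r - (2 - r) * x ≠ 0) (hx' : 1 - x * (3 - 2 * r) ≠ 0) :
    4 - 2 / (2 - r + 2 * r / (1 - x)) = 2 - r + 2 * r / (1 - x * (3 - 2 * r)) := by
  have h : 2 - r + 2 * r / (1 - x) = (2 + r - (2 - r) * x) / (1 - x) := by
    field_simp
    ring
  rw [h, div_div_eq_mul_div, sub_eq_iff_eq_add, ← sub_eq_zero]
  field_simp
  grind

theorem stmt_0 (q : ℕ → ℝ) (h1 : q 1 = 4)
    (hrec : ∀ t : ℕ, 2 ≤ t → q t = 4 - 2 / q (t - 1)) :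
    ∀ t : ℕ, 1 ≤ t →
      q t = 2 - Real.sqrt 2 + 2 * Real.sqrt 2 / (1 - (3 - 2 * Real.sqrt 2) ^ t) := by
  have hr : Real.sqrt 2 ^ 2 = 2 := Real.sq_sqrt (by norm_num)
  have hr_gt : 1 < Real.sqrt 2 := Real.lt_sqrt_of_sq_lt (by norm_num)
  have hr_lt : Real.sqrt 2 < 3 / 2 := (Real.sqrt_lt' (by norm_num)).2 (by norm_num)
  have hpow_lt : ∀ t : ℕ, 1 ≤ t → (3 - 2 * Real.sqrt 2) ^ t < 1 := fun t ht =>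
    pow_lt_one₀ (by linarith) (by linarith) (by lia)
  intro t ht
  induction t, ht using Nat.le_induction with
  | base =>
    have h : 1 - (3 - 2 * Real.sqrt 2) ≠ 0 := by linarith
    rw [h1, pow_one]
    field_simp
    grind
  | succ t ht ih =>
    have hx := hpow_lt t ht
    have hx' := hpow_lt (t + 1) (by lia)
    rw [pow_succ] at hx' ⊢
    rw [hrec (t + 1) (by lia), Nat.add_sub_cancel, ih]
    exact four_sub_two_div_eq hr (by linarith) (by nlinarith) (by linarith)
end

section
/- Let s, g : ℕ → ℤ be sequences satisfying s(0) = 1, g(0) = 1, and for all t ≥ 1 the joint recursion s(t) = 2·s(t−1)² + 2·s(t−1)·g(t−1) and g(t) = s(t−1)² + 2·s(t−1)·g(t−1). Then s(1) = 4 and for all t ≥ 2, s(t) = 4·s(t−1)² − 2·s(t−1)·s(t−2)². -/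
theorem stmt_4 (s g : ℕ → ℤ) (hs0 : s 0 = 1) (hg0 : g 0 = 1)
    (hs : ∀ t : ℕ, 1 ≤ t → s t = 2 * (s (t - 1)) ^ 2 + 2 * s (t - 1) * g (t - 1))
    (hg : ∀ t : ℕ, 1 ≤ t → g t = (s (t - 1)) ^ 2 + 2 * s (t - 1) * g (t - 1)) :
    s 1 = 4 ∧
      ∀ t : ℕ, 2 ≤ t → s t = 4 * (s (t - 1)) ^ 2 - 2 * s (t - 1) * (s (t - 2)) ^ 2 := by
  refine ⟨by simp [hs 1 le_rfl, hs0, hg0], fun t ht => ?_⟩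
  obtain ⟨n, rfl⟩ := Nat.exists_eq_add_of_le' ht
  have hs₂ : s (n + 2) = 2 * s (n + 1) ^ 2 + 2 * s (n + 1) * g (n + 1) := hs (n + 2) (by omega)
  have hs₁ : s (n + 1) = 2 * s n ^ 2 + 2 * s n * g n := hs (n + 1) (by omega)
  have hg₁ : g (n + 1) = s n ^ 2 + 2 * s n * g n := hg (n + 1) (by omega)
  change s (n + 2) = 4 * s (n + 1) ^ 2 - 2 * s (n + 1) * s n ^ 2
  linear_combination hs₂ + 2 * s (n + 1) * (hg₁ - hs₁)
end

section
/- Let s : ℕ → ℤ be the sequence defined by s(0) = 1, s(1) = 4, and s(t) = 4·s(t−1)² − 2·s(t−1)·s(t−2)² for all t ≥ 2. Then for every t ≥ 1, (s(t) : ℝ) = ∏_{i=1}^{t} (2 − √2 + 2√2/(1 − (3 − 2√2)^i))^{2^{t−i}}. -/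
theorem prod_Icc_pow_two_pow_succ {R : Type*} [CommMonoid R] (f : ℕ → R) (t : ℕ) :
    ∏ i ∈ Finset.Icc 1 (t + 1), f i ^ 2 ^ (t + 1 - i) =
      (∏ i ∈ Finset.Icc 1 t, f i ^ 2 ^ (t - i)) ^ 2 * f (t + 1) := by
  rw [Finset.prod_Icc_succ_top (by omega), ← Finset.prod_pow]
  congr 1
  · refine Finset.prod_congr rfl fun i hi => ?_
    rw [Nat.succ_sub (Finset.mem_Icc.mp hi).2, pow_succ, pow_mul]
  · simp

theorem three_sub_two_mul_sqrt_two_pow_lt_one {i : ℕ} (hi : i ≠ 0) :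
    (3 - 2 * Real.sqrt 2) ^ i < 1 := by
  have h : Real.sqrt 2 ^ 2 = 2 := Real.sq_sqrt (by norm_num)
  have h0 := Real.sqrt_nonneg 2
  exact pow_lt_one₀ (by nlinarith) (by nlinarith) hi

/-- The closed form solves the Riccati recurrence `r (i + 1) = 4 - 2 / r i`. -/
theorem riccati_closed_form {i : ℕ} (hi : i ≠ 0) :
    (2 - Real.sqrt 2 + 2 * Real.sqrt 2 / (1 - (3 - 2 * Real.sqrt 2) ^ i)) *
        (2 - Real.sqrt 2 + 2 * Real.sqrt 2 / (1 - (3 - 2 * Real.sqrt 2) ^ (i + 1))) =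
      4 * (2 - Real.sqrt 2 + 2 * Real.sqrt 2 / (1 - (3 - 2 * Real.sqrt 2) ^ i)) - 2 := by
  have hx := (sub_pos.mpr (three_sub_two_mul_sqrt_two_pow_lt_one hi)).ne'
  have hy := (sub_pos.mpr (three_sub_two_mul_sqrt_two_pow_lt_one i.succ_ne_zero)).ne'
  have h : Real.sqrt 2 ^ 2 = 2 := Real.sq_sqrt (by norm_num)
  rw [Nat.succ_eq_add_one, pow_succ] at hy
  rw [pow_succ]
  generalize (3 - 2 * Real.sqrt 2) ^ i = x at *
  generalize Real.sqrt 2 = c at *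
  grind

theorem stmt_6 (s : ℕ → ℤ) (hs0 : s 0 = 1) (hs1 : s 1 = 4)
    (hrec : ∀ t : ℕ, 2 ≤ t → s t = 4 * (s (t - 1)) ^ 2 - 2 * s (t - 1) * (s (t - 2)) ^ 2) :
    ∀ t : ℕ, 1 ≤ t →
      (s t : ℝ) =
        ∏ i ∈ Finset.Icc 1 t,
          (2 - Real.sqrt 2 + 2 * Real.sqrt 2 / (1 - (3 - 2 * Real.sqrt 2) ^ i)) ^ (2 ^ (t - i)) := by
  intro t _
  set r : ℕ → ℝ := fun i =>
    2 - Real.sqrt 2 + 2 * Real.sqrt 2 / (1 - (3 - 2 * Real.sqrt 2) ^ i) with hr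
  have hstep (n : ℕ) : (s (n + 1) : ℝ) = (s n : ℝ) ^ 2 * r (n + 1) := by
    induction n with
    | zero =>
      have h : Real.sqrt 2 ^ 2 = 2 := Real.sq_sqrt (by norm_num)
      have hx := (sub_pos.mpr (three_sub_two_mul_sqrt_two_pow_lt_one one_ne_zero)).ne'
      rw [pow_one] at hx
      simp only [hr, zero_add, hs0, hs1, pow_one]
      push_cast
      field_simp
      linear_combination 2 * h
    | succ n ih =>
      have hs : (s (n + 2) : ℝ) = 4 * (s (n + 1) : ℝ) ^ 2 - 2 * s (n + 1) * (s n : ℝ) ^ 2 := by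
        exact_mod_cast hrec (n + 2) (by omega)
      have hric : r (n + 1) * r (n + 2) = 4 * r (n + 1) - 2 :=
        riccati_closed_form n.succ_ne_zero
      linear_combination hs - (s (n + 1) : ℝ) * (s n : ℝ) ^ 2 * hric +
        (s (n + 1) : ℝ) * (4 - r (n + 2)) * ih
  change (s t : ℝ) = ∏ i ∈ Finset.Icc 1 t, r i ^ 2 ^ (t - i)
  clear_value r
  induction t with
  | zero => simp [hs0]
  | succ n ih =>
    rw [prod_Icc_pow_two_pow_succ, hstep]
    rcases n.eq_zero_or_pos with rfl | hn
    · simp [hs0]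
    · rw [ih hn]
end

section
/- For every t ≥ 1, the real number ∏_{i=1}^{t} (2 − √2 + 2√2/(1 − (3 − 2√2)^i))^{2^{t−i}} is a positive integer. -/
/-- The sequence `((√2 + 1) ^ n - (√2 - 1) ^ n) / 2`, whose terms are alternately
integer multiples of `√2` and integers. -/
noncomputable def silverSeq (n : ℕ) : ℝ :=
  ((Real.sqrt 2 + 1) ^ n - (Real.sqrt 2 - 1) ^ n) / 2

/-- The factor contributed by level `i` of the recursive construction. -/
noncomputable def levelFactor (i : ℕ) : ℝ :=
  2 - Real.sqrt 2 + 2 * Real.sqrt 2 / (1 - (3 - 2 * Real.sqrt 2) ^ i)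

lemma sq_sqrt_two : Real.sqrt 2 ^ 2 = 2 := Real.sq_sqrt (by norm_num)

lemma one_lt_sqrt_two : 1 < Real.sqrt 2 := by
  nlinarith [sq_sqrt_two, Real.sqrt_nonneg 2]

lemma sqrt_two_lt : Real.sqrt 2 < 3 / 2 := by
  nlinarith [sq_sqrt_two, Real.sqrt_nonneg 2]

lemma silverSeq_add_two (n : ℕ) :
    silverSeq (n + 2) = 2 * Real.sqrt 2 * silverSeq (n + 1) - silverSeq n := by
  simp only [silverSeq, pow_succ]
  linear_combination
    (((Real.sqrt 2 - 1) ^ n - (Real.sqrt 2 + 1) ^ n) / 2) * sq_sqrt_two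

lemma levelFactor_pos (i : ℕ) : 0 < levelFactor i := by
  have h1 := one_lt_sqrt_two
  have h2 := sqrt_two_lt
  have hq : (3 - 2 * Real.sqrt 2) ^ i ≤ 1 := pow_le_one₀ (by linarith) (by linarith)
  have : 0 ≤ 2 * Real.sqrt 2 / (1 - (3 - 2 * Real.sqrt 2) ^ i) :=
    div_nonneg (by linarith) (by linarith)
  unfold levelFactor
  linarith

lemma levelFactor_mul_silverSeq {i : ℕ} (hi : i ≠ 0) :
    levelFactor i * silverSeq i = Real.sqrt 2 * silverSeq (i + 1) := by
  have h1 := one_lt_sqrt_two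
  have h2 := sqrt_two_lt
  have hq : (3 - 2 * Real.sqrt 2) ^ i < 1 := pow_lt_one₀ (by linarith) (by linarith) hi
  have hD : 1 - (3 - 2 * Real.sqrt 2) ^ i ≠ 0 := by linarith
  have hprod : (3 - 2 * Real.sqrt 2) ^ i * (Real.sqrt 2 + 1) ^ i = (Real.sqrt 2 - 1) ^ i := by
    rw [← mul_pow]
    congr 1
    linear_combination (-2) * sq_sqrt_two
  have hdiv : 2 * Real.sqrt 2 / (1 - (3 - 2 * Real.sqrt 2) ^ i) * silverSeq i
      = Real.sqrt 2 * (Real.sqrt 2 + 1) ^ i := by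
    rw [div_mul_eq_mul_div, div_eq_iff hD, silverSeq]
    linear_combination Real.sqrt 2 * hprod
  rw [levelFactor, add_mul, hdiv]
  simp only [silverSeq, pow_succ]
  linear_combination
    (((Real.sqrt 2 - 1) ^ i - (Real.sqrt 2 + 1) ^ i) / 2) * sq_sqrt_two

lemma prod_levelFactor_succ (t : ℕ) :
    ∏ i ∈ Finset.Icc 1 (t + 1), levelFactor i ^ 2 ^ (t + 1 - i)
      = (∏ i ∈ Finset.Icc 1 t, levelFactor i ^ 2 ^ (t - i)) ^ 2 * levelFactor (t + 1) := by
  rw [Finset.prod_Icc_succ_top (by omega), ← Finset.prod_pow, Nat.sub_self, pow_zero, pow_one]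
  congr 1
  refine Finset.prod_congr rfl fun i hi => ?_
  rw [← pow_mul, ← pow_succ, Nat.sub_add_comm (Finset.mem_Icc.1 hi).2]

lemma prod_levelFactor_eq (t : ℕ) :
    (∃ x y c : ℤ, silverSeq (t + 1) = x ∧ silverSeq (t + 2) = Real.sqrt 2 * y ∧
      ∏ i ∈ Finset.Icc 1 t, levelFactor i ^ 2 ^ (t - i) = silverSeq (t + 1) * c) ∨
    (∃ x y c : ℤ, silverSeq (t + 1) = Real.sqrt 2 * x ∧ silverSeq (t + 2) = y ∧
      ∏ i ∈ Finset.Icc 1 t, levelFactor i ^ 2 ^ (t - i)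
        = silverSeq (t + 1) * (Real.sqrt 2 * c)) := by
  induction t with
  | zero =>
    refine Or.inl ⟨1, 2, 1, ?_, ?_, ?_⟩
    · simp [silverSeq]
    · simp [silverSeq]
      ring
    · simp [silverSeq]
  | succ t ih =>
    have hf := levelFactor_mul_silverSeq (Nat.succ_ne_zero t)
    have hrec := silverSeq_add_two (t + 1)
    simp only [Nat.succ_eq_add_one, add_assoc, Nat.reduceAdd] at hf hrec ⊢
    rcases ih with ⟨x, y, c, hx, hy, hP⟩ | ⟨x, y, c, hx, hy, hP⟩
    · refine Or.inr ⟨y, 4 * y - x, x * c ^ 2, hy, ?_, ?_⟩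
      · rw [hrec, hx, hy]
        push_cast
        linear_combination 2 * (y : ℝ) * sq_sqrt_two
      · rw [prod_levelFactor_succ, hP]
        push_cast
        rw [← hx]
        linear_combination silverSeq (t + 1) * (c : ℝ) ^ 2 * hf
    · refine Or.inl ⟨y, 2 * y - x, 4 * x * c ^ 2, hy, ?_, ?_⟩
      · rw [hrec, hx, hy]
        push_cast
        ring
      · rw [prod_levelFactor_succ, hP]
        push_cast
        rw [hx] at hf ⊢
        linear_combination Real.sqrt 2 ^ 3 * (x : ℝ) * (c : ℝ) ^ 2 * hf
          + (Real.sqrt 2 ^ 2 + 2) * (x : ℝ) * (c : ℝ) ^ 2 * silverSeq (t + 2) * sq_sqrt_two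

theorem stmt_7 :
    ∀ t : ℕ, 1 ≤ t →
      ∃ n : ℕ, 0 < n ∧
        (∏ i ∈ Finset.Icc 1 t,
          (2 - Real.sqrt 2 + 2 * Real.sqrt 2 / (1 - (3 - 2 * Real.sqrt 2) ^ i)) ^ (2 ^ (t - i)))
          = (n : ℝ) := by
  intro t _
  change ∃ n : ℕ, 0 < n ∧ ∏ i ∈ Finset.Icc 1 t, levelFactor i ^ 2 ^ (t - i) = (n : ℝ)
  have hpos : 0 < ∏ i ∈ Finset.Icc 1 t, levelFactor i ^ 2 ^ (t - i) :=
    Finset.prod_pos fun i _ => pow_pos (levelFactor_pos i) _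
  obtain ⟨z, hz⟩ :
      ∃ z : ℤ, ∏ i ∈ Finset.Icc 1 t, levelFactor i ^ 2 ^ (t - i) = (z : ℝ) := by
    rcases prod_levelFactor_eq t with ⟨x, y, c, hx, -, hP⟩ | ⟨x, y, c, hx, -, hP⟩
    · exact ⟨x * c, by rw [hP, hx]; push_cast; ring⟩
    · refine ⟨2 * x * c, ?_⟩
      rw [hP, hx]
      push_cast
      linear_combination (x : ℝ) * c * sq_sqrt_two
  have hz0 : 0 < z := by
    rw [hz] at hpos
    exact_mod_cast hpos
  lift z to ℕ using hz0.le
  exact ⟨z, by exact_mod_cast hz0, by rw [hz]; norm_cast⟩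
end

section
/- Let s : ℕ → ℤ be the sequence defined by s(0) = 1, s(1) = 4, and s(t) = 4·s(t−1)² − 2·s(t−1)·s(t−2)² for all t ≥ 2. Then the sequence t ↦ (ln s(t))/2^{t+1} converges as t → ∞, and its limit equals (1/2) · Σ_{i=1}^{∞} 2^{−i} · ln(2 − √2 + 2√2/(1 − (3 − 2√2)^i)). -/
/-- The closed form of the ratio `s (i + 1) / s i ^ 2`. -/
noncomputable def squareRatio (i : ℕ) : ℝ :=
  2 - Real.sqrt 2 + 2 * Real.sqrt 2 / (1 - (3 - 2 * Real.sqrt 2) ^ (i + 1))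

lemma three_sub_two_mul_sqrt_two_mem_Ioo : 3 - 2 * Real.sqrt 2 ∈ Set.Ioo (0 : ℝ) 1 := by
  have h := Real.sq_sqrt (show (0 : ℝ) ≤ 2 by norm_num)
  have h0 := Real.sqrt_nonneg 2
  constructor <;> nlinarith

lemma one_sub_pow_succ_pos (i : ℕ) : 0 < 1 - (3 - 2 * Real.sqrt 2) ^ (i + 1) :=
  sub_pos.2 <| pow_lt_one₀ three_sub_two_mul_sqrt_two_mem_Ioo.1.le
    three_sub_two_mul_sqrt_two_mem_Ioo.2 i.succ_ne_zero

lemma squareRatio_zero : squareRatio 0 = 4 := by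
  have h := Real.sq_sqrt (show (0 : ℝ) ≤ 2 by norm_num)
  have hd := (one_sub_pow_succ_pos 0).ne'
  unfold squareRatio
  field_simp
  linear_combination (-2 : ℝ) * h

lemma one_le_squareRatio (i : ℕ) : 1 ≤ squareRatio i := by
  have hd := one_sub_pow_succ_pos i
  have hq : 0 < (3 - 2 * Real.sqrt 2) ^ (i + 1) :=
    pow_pos three_sub_two_mul_sqrt_two_mem_Ioo.1 _
  have h0 := Real.sqrt_nonneg 2
  have : 2 * Real.sqrt 2 ≤ 2 * Real.sqrt 2 / (1 - (3 - 2 * Real.sqrt 2) ^ (i + 1)) :=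
    le_div_self (by positivity) hd (by linarith)
  unfold squareRatio
  linarith

lemma squareRatio_succ_mul (i : ℕ) :
    squareRatio (i + 1) * squareRatio i = 4 * squareRatio i - 2 := by
  have h := Real.sq_sqrt (show (0 : ℝ) ≤ 2 by norm_num)
  have hd := (one_sub_pow_succ_pos i).ne'
  have hd' := (one_sub_pow_succ_pos (i + 1)).ne'
  unfold squareRatio
  rw [pow_succ _ (i + 1)] at hd' ⊢
  generalize (3 - 2 * Real.sqrt 2) ^ (i + 1) = q at *
  generalize Real.sqrt 2 = x at *
  field_simp
  linear_combination (1 - (2 * x + 4) * q + (3 - 2 * x) * q ^ 2) * h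

lemma squareRatio_le_four (i : ℕ) : squareRatio i ≤ 4 := by
  cases i with
  | zero => exact squareRatio_zero.le
  | succ i => nlinarith [squareRatio_succ_mul i, one_le_squareRatio i]

lemma summable_log_squareRatio :
    Summable fun i : ℕ => (2 : ℝ) ^ (-((i + 1 : ℕ) : ℝ)) * Real.log (squareRatio i) := by
  have hg : Summable fun i : ℕ => (1 / 2 : ℝ) ^ i * Real.log 4 :=
    summable_geometric_two.mul_right _
  refine hg.of_nonneg_of_le
    (fun i => mul_nonneg (by positivity) (Real.log_nonneg (one_le_squareRatio i))) fun i => ?_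
  have h1 := one_le_squareRatio i
  gcongr
  · exact Real.log_nonneg h1
  · rw [Real.rpow_neg zero_le_two, Real.rpow_natCast, one_div, inv_pow]
    gcongr <;> norm_num
  · exact squareRatio_le_four i

lemma pos_and_eq_squareRatio_mul_sq {u : ℕ → ℝ} (h0 : u 0 = 1) (h1 : u 1 = 4)
    (hrec : ∀ t, u (t + 2) = 4 * u (t + 1) ^ 2 - 2 * u (t + 1) * u t ^ 2) (t : ℕ) :
    0 < u t ∧ u (t + 1) = squareRatio t * u t ^ 2 := by
  induction t with
  | zero => simp [h0, h1, squareRatio_zero]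
  | succ t ih =>
    obtain ⟨hpos, heq⟩ := ih
    have hr := one_le_squareRatio t
    refine ⟨by rw [heq]; positivity, ?_⟩
    rw [hrec, heq]
    linear_combination (-(u t ^ 4 * squareRatio t)) * squareRatio_succ_mul t

lemma log_div_two_pow_eq_sum {u r : ℕ → ℝ} (h0 : u 0 = 1) (hr : ∀ t, 0 < r t)
    (hu : ∀ t, 0 < u t) (hrec : ∀ t, u (t + 1) = r t * u t ^ 2) (t : ℕ) :
    Real.log (u t) / 2 ^ (t + 1) = (1 / 2) *
      ∑ i ∈ Finset.range t, (2 : ℝ) ^ (-((i + 1 : ℕ) : ℝ)) * Real.log (r i) := by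
  induction t with
  | zero => simp [h0]
  | succ t ih =>
    rw [Finset.sum_range_succ, mul_add, ← ih, hrec,
      Real.log_mul (hr t).ne' (pow_pos (hu t) 2).ne', Real.log_pow,
      Real.rpow_neg zero_le_two, Real.rpow_natCast]
    field_simp
    push_cast
    ring

theorem stmt_9 (s : ℕ → ℤ) (hs0 : s 0 = 1) (hs1 : s 1 = 4)
    (hrec : ∀ t : ℕ, 2 ≤ t → s t = 4 * (s (t - 1)) ^ 2 - 2 * s (t - 1) * (s (t - 2)) ^ 2) :
    Filter.Tendsto (fun t : ℕ => Real.log (s t) / 2 ^ (t + 1)) Filter.atTop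
      (nhds ((1 / 2) * ∑' i : ℕ,
        (2 : ℝ) ^ (-((i + 1 : ℕ) : ℝ)) *
          Real.log (2 - Real.sqrt 2 +
            2 * Real.sqrt 2 / (1 - (3 - 2 * Real.sqrt 2) ^ (i + 1))))) := by
  have hs0' : (s 0 : ℝ) = 1 := by simp [hs0]
  have key := pos_and_eq_squareRatio_mul_sq (u := fun t => (s t : ℝ)) hs0' (by simp [hs1])
    fun t => by exact_mod_cast hrec (t + 2) (by lia)
  refine (summable_log_squareRatio.hasSum.tendsto_sum_nat.const_mul (1 / 2)).congr fun t => ?_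
  exact (log_div_two_pow_eq_sum (u := fun t => (s t : ℝ)) hs0'
    (fun i => zero_lt_one.trans_le (one_le_squareRatio i))
    (fun t => (key t).1) (fun t => (key t).2) t).symm
end

section
/- Let h = (1/2) · Σ_{i=1}^{∞} 2^{−i} · ln(2 − √2 + 2√2/(1 − (3 − 2√2)^i)). Then 0.65 < h < 0.66. -/
open Real in
/-- Every term after the first has its logarithm's argument between `17 / 5` and `7 / 2`. -/
lemma argument_mem_Icc (i : ℕ) :
    2 - √2 + 2 * √2 / (1 - (3 - 2 * √2) ^ (i + 2)) ∈ Set.Icc (17 / 5 : ℝ) (7 / 2) := by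
  have hsq : √2 * √2 = 2 := mul_self_sqrt zero_le_two
  have hlo : 1.414 < √2 := by rw [lt_sqrt] <;> norm_num
  have hhi : √2 < 1.4143 := by rw [sqrt_lt'] <;> norm_num
  have hpos : 0 < (3 - 2 * √2) ^ (i + 2) := pow_pos (by linarith) _
  have hle : (3 - 2 * √2) ^ (i + 2) ≤ (3 - 2 * √2) ^ 2 :=
    pow_le_pow_of_le_one (by linarith) (by linarith) (by lia)
  have hr2 : (3 - 2 * √2) ^ 2 = 17 - 12 * √2 := by linear_combination 4 * hsq
  rw [hr2] at hle
  generalize (3 - 2 * √2) ^ (i + 2) = x at *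
  have hden : 0 < 1 - x := by linarith
  constructor
  · have : 2 * √2 ≤ 2 * √2 / (1 - x) := by
      rw [le_div_iff₀ hden]
      nlinarith
    linarith
  · have : 2 * √2 / (1 - x) ≤ 3 / 2 + √2 := by
      rw [div_le_iff₀ hden]
      nlinarith
    linarith

open Real in
lemma argument_zero : 2 - √2 + 2 * √2 / (1 - (3 - 2 * √2) ^ (0 + 1)) = 4 := by
  have hsq : √2 * √2 = 2 := mul_self_sqrt zero_le_two
  have hlo : 1.414 < √2 := by rw [lt_sqrt] <;> norm_num
  have hden : 1 - (3 - 2 * √2) ^ (0 + 1) ≠ 0 := by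
    rw [zero_add, pow_one]
    linarith
  field_simp
  linear_combination -2 * hsq

lemma log_seven_halves_lt : Real.log (7 / 2) < 1.2537 := by
  have h := Real.log_lt_log (by norm_num) (show (7 / 2 : ℝ) ^ 26 < 2 ^ 47 by norm_num)
  rw [Real.log_pow, Real.log_pow] at h
  push_cast at h
  linarith [Real.log_two_lt_d9]

lemma lt_log_seventeen_fifths : 1.215 < Real.log (17 / 5) := by
  have h := Real.log_lt_log (by norm_num) (show (2 : ℝ) ^ 44 < (17 / 5) ^ 25 by norm_num)
  rw [Real.log_pow, Real.log_pow] at h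
  push_cast at h
  linarith [Real.log_two_gt_d9]

/-- Bounds on a dyadically weighted sum whose terms after the first lie in `[a, b]`. -/
lemma tsum_dyadic_mem_Icc {u : ℕ → ℝ} {a b : ℝ} (hu : ∀ i, u (i + 1) ∈ Set.Icc a b) :
    ∑' i : ℕ, (2 : ℝ) ^ (-((i + 1 : ℕ) : ℝ)) * u i ∈
      Set.Icc (u 0 / 2 + a / 2) (u 0 / 2 + b / 2) := by
  have hw (i : ℕ) : (2 : ℝ) ^ (-((i + 1 : ℕ) : ℝ)) = 1 / 2 * (1 / 2) ^ i := by
    rw [Real.rpow_neg zero_le_two, Real.rpow_natCast, pow_succ, one_div, inv_pow, mul_inv, mul_comm]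
  simp_rw [hw]
  have hgeom (c : ℝ) : HasSum (fun i : ℕ ↦ 1 / 2 * (1 / 2) ^ (i + 1) * c) (c / 2) := by
    have h := hasSum_geometric_two.mul_left (c / 4)
    rw [show c / 4 * 2 = c / 2 by ring] at h
    rwa [show (fun i : ℕ ↦ 1 / 2 * (1 / 2) ^ (i + 1) * c) = fun i ↦ c / 4 * (1 / 2) ^ i by
      funext i; ring]
  have hnonneg (i : ℕ) : (0 : ℝ) ≤ 1 / 2 * (1 / 2) ^ (i + 1) := by positivity
  have htail : Summable fun i : ℕ ↦ 1 / 2 * (1 / 2) ^ (i + 1) * u (i + 1) := by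
    have h : Summable fun i : ℕ ↦ 1 / 2 * (1 / 2) ^ (i + 1) * (u (i + 1) - a) :=
      .of_nonneg_of_le (fun i ↦ mul_nonneg (hnonneg i) (by linarith [(hu i).1]))
        (fun i ↦ mul_le_mul_of_nonneg_left (by linarith [(hu i).2]) (hnonneg i))
        (hgeom (b - a)).summable
    refine (h.add (hgeom a).summable).congr fun i ↦ ?_
    ring
  have hlower := hasSum_le (fun i ↦ mul_le_mul_of_nonneg_left (hu i).1 (hnonneg i))
    (hgeom a) htail.hasSum
  have hupper := hasSum_le (fun i ↦ mul_le_mul_of_nonneg_left (hu i).2 (hnonneg i))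
    htail.hasSum (hgeom b)
  rw [((summable_nat_add_iff (f := fun i : ℕ ↦ 1 / 2 * (1 / 2) ^ i * u i) 1).1
    htail).tsum_eq_zero_add]
  constructor <;> linarith

theorem stmt_10 :
    0.65 < (1 / 2 : ℝ) * ∑' i : ℕ,
        (2 : ℝ) ^ (-((i + 1 : ℕ) : ℝ)) *
          Real.log (2 - Real.sqrt 2 +
            2 * Real.sqrt 2 / (1 - (3 - 2 * Real.sqrt 2) ^ (i + 1))) ∧
      (1 / 2 : ℝ) * ∑' i : ℕ,
        (2 : ℝ) ^ (-((i + 1 : ℕ) : ℝ)) *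
          Real.log (2 - Real.sqrt 2 +
            2 * Real.sqrt 2 / (1 - (3 - 2 * Real.sqrt 2) ^ (i + 1))) < 0.66 := by
  have h := tsum_dyadic_mem_Icc (a := Real.log (17 / 5)) (b := Real.log (7 / 2))
    (u := fun i ↦ Real.log (2 - √2 + 2 * √2 / (1 - (3 - 2 * √2) ^ (i + 1))))
    fun i ↦ by
      obtain ⟨hlo, hhi⟩ := argument_mem_Icc i
      exact ⟨Real.log_le_log (by norm_num) hlo, Real.log_le_log (by linarith) hhi⟩
  have hfour : Real.log 4 = 2 * Real.log 2 := by
    rw [show (4 : ℝ) = 2 ^ 2 by norm_num, Real.log_pow, Nat.cast_ofNat]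
  simp only [argument_zero, hfour] at h
  obtain ⟨hlower, hupper⟩ := h
  constructor
  · linarith [Real.log_two_gt_d9, lt_log_seventeen_fifths]
  · linarith [Real.log_two_lt_d9, log_seven_halves_lt]
end

section
/- Let q : ℕ → ℝ be defined by q(t) = 2 − √2 + 2√2/(1 − (3 − 2√2)^t) for t ≥ 1. Then q(1) = 4 and for every t ≥ 2, q(t) = 4 − 2/q(t−1). -/
theorem stmt_12 (q : ℕ → ℝ)
    (hq : ∀ t : ℕ, 1 ≤ t →
      q t = 2 - Real.sqrt 2 + 2 * Real.sqrt 2 / (1 - (3 - 2 * Real.sqrt 2) ^ t)) :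
    q 1 = 4 ∧ ∀ t : ℕ, 2 ≤ t → q t = 4 - 2 / q (t - 1) := by
  have hs : Real.sqrt 2 ^ 2 = 2 := Real.sq_sqrt (by norm_num)
  have hs0 : 0 ≤ Real.sqrt 2 := Real.sqrt_nonneg 2
  generalize Real.sqrt 2 = s at *
  have hs1 : 1 < s := by nlinarith
  have hs2 : s < 3 / 2 := by nlinarith
  have pow_lt (t : ℕ) (ht : t ≠ 0) : (3 - 2 * s) ^ t < 1 :=
    pow_lt_one₀ (by linarith) (by linarith) ht
  constructor
  · have h : 1 - (3 - 2 * s) ≠ 0 := by linarith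
    rw [hq 1 le_rfl, pow_one]
    field_simp
    linear_combination -2 * hs
  · intro t ht
    obtain ⟨n, rfl⟩ : ∃ n, t = n + 1 := ⟨t - 1, by lia⟩
    have hy := pow_lt n (by lia)
    have hx := pow_lt (n + 1) (by lia)
    have hy0 : 0 < (3 - 2 * s) ^ n := pow_pos (by linarith) n
    rw [Nat.add_sub_cancel, hq (n + 1) (by lia), hq n (by lia)]
    rw [pow_succ] at hx ⊢
    generalize (3 - 2 * s) ^ n = y at *
    have hx' : 1 - y * (3 - 2 * s) ≠ 0 := by linarith
    have hy' : 1 - y ≠ 0 := by linarith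
    have hN : 2 + s - (2 - s) * y ≠ 0 := by nlinarith
    have hprev : 2 - s + 2 * s / (1 - y) = (2 + s - (2 - s) * y) / (1 - y) := by
      field_simp
      ring
    rw [hprev, div_div_eq_mul_div]
    field_simp
    grind
end

section
/- Let s : ℕ → ℤ be the sequence defined by s(0) = 1, s(1) = 4, and s(t) = 4·s(t−1)² − 2·s(t−1)·s(t−2)² for all t ≥ 2. Then for all t ≥ 1, (2 + √2)^{2^t − 1} ≤ (s(t) : ℝ) ≤ 4^{2^t − 1}. -/
theorem two_pow_succ_sub_one (n : ℕ) : 2 ^ (n + 1) - 1 = (2 ^ n - 1) * 2 + 1 := by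
  have := Nat.one_le_two_pow (n := n)
  omega

/-- A sequence with `a * s n ^ 2 ≤ s (n + 1)` and `1 ≤ s 0` grows at least like `a ^ (2 ^ n - 1)`. -/
theorem pow_two_pow_sub_one_le {s : ℕ → ℝ} {a : ℝ} (ha : 0 ≤ a) (h0 : 1 ≤ s 0)
    (h : ∀ n, a * s n ^ 2 ≤ s (n + 1)) (n : ℕ) : a ^ (2 ^ n - 1) ≤ s n := by
  induction n with
  | zero => simpa using h0
  | succ n ih =>
    calc a ^ (2 ^ (n + 1) - 1) = a * (a ^ (2 ^ n - 1)) ^ 2 := by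
          rw [two_pow_succ_sub_one, pow_succ, pow_mul, mul_comm]
      _ ≤ a * s n ^ 2 := by gcongr
      _ ≤ s (n + 1) := h n

/-- A positive sequence with `s (n + 1) ≤ a * s n ^ 2` and `s 0 ≤ 1` grows at most like
`a ^ (2 ^ n - 1)`. -/
theorem le_pow_two_pow_sub_one {s : ℕ → ℝ} {a : ℝ} (ha : 0 ≤ a) (hs : ∀ n, 0 < s n)
    (h0 : s 0 ≤ 1) (h : ∀ n, s (n + 1) ≤ a * s n ^ 2) (n : ℕ) : s n ≤ a ^ (2 ^ n - 1) := by
  induction n with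
  | zero => simpa using h0
  | succ n ih =>
    have hn := (hs n).le
    calc s (n + 1) ≤ a * s n ^ 2 := h n
      _ ≤ a * (a ^ (2 ^ n - 1)) ^ 2 := by gcongr
      _ = a ^ (2 ^ (n + 1) - 1) := by
          rw [two_pow_succ_sub_one, pow_succ _ (_ * 2), pow_mul, mul_comm]

/-- The ratio `s (n + 1) / s n ^ 2` stays between `2 + √2` and `4`. -/
theorem ratio_bounds {s : ℕ → ℝ} (h0 : s 0 = 1) (h1 : s 1 = 4)
    (hrec : ∀ n, s (n + 2) = 4 * s (n + 1) ^ 2 - 2 * s (n + 1) * s n ^ 2) (n : ℕ) :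
    0 < s n ∧ (2 + √2) * s n ^ 2 ≤ s (n + 1) ∧ s (n + 1) ≤ 4 * s n ^ 2 := by
  have hsq : √2 ^ 2 = (2 : ℝ) := Real.sq_sqrt (by norm_num)
  have hpos : 0 ≤ √(2 : ℝ) := Real.sqrt_nonneg 2
  have hlt : √(2 : ℝ) < 2 := by nlinarith
  induction n with
  | zero => norm_num [h0, h1]; linarith
  | succ n ih =>
    obtain ⟨hn, hlow, -⟩ := ih
    have hn1 : 0 < s (n + 1) := lt_of_lt_of_le (by positivity) hlow
    have key : 2 * s n ^ 2 ≤ (2 - √2) * s (n + 1) := by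
      calc 2 * s n ^ 2 = (2 - √2) * ((2 + √2) * s n ^ 2) := by
            linear_combination s n ^ 2 * hsq
        _ ≤ (2 - √2) * s (n + 1) := mul_le_mul_of_nonneg_left hlow (by linarith)
    refine ⟨hn1, ?_, ?_⟩ <;> rw [hrec n]
    · linarith [mul_le_mul_of_nonneg_left key hn1.le]
    · have : 0 ≤ 2 * s (n + 1) * s n ^ 2 := by positivity
      linarith

theorem stmt_13 (s : ℕ → ℤ) (hs0 : s 0 = 1) (hs1 : s 1 = 4)
    (hrec : ∀ t : ℕ, 2 ≤ t → s t = 4 * (s (t - 1)) ^ 2 - 2 * s (t - 1) * (s (t - 2)) ^ 2) :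
    ∀ t : ℕ, 1 ≤ t →
      (2 + Real.sqrt 2) ^ (2 ^ t - 1) ≤ (s t : ℝ) ∧ (s t : ℝ) ≤ 4 ^ (2 ^ t - 1) := by
  intro t _
  have h0 : (s 0 : ℝ) = 1 := by simp [hs0]
  have h1 : (s 1 : ℝ) = 4 := by simp [hs1]
  have h2 (n : ℕ) : (s (n + 2) : ℝ) =
      4 * (s (n + 1) : ℝ) ^ 2 - 2 * (s (n + 1) : ℝ) * (s n : ℝ) ^ 2 := by
    exact_mod_cast hrec (n + 2) (by omega)
  have h := ratio_bounds (s := fun n => (s n : ℝ)) h0 h1 h2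
  exact ⟨pow_two_pow_sub_one_le (s := fun n => (s n : ℝ)) (by positivity) h0.ge
      (fun n => (h n).2.1) t,
    le_pow_two_pow_sub_one (s := fun n => (s n : ℝ)) (by norm_num) (fun n => (h n).1) h0.le
      (fun n => (h n).2.2) t⟩
end
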